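/- ∑_{A ⊆ Δ_n^+(𝔩)} ∑_{C ⊆ Δ(𝔭_1)} (−1)^{|A|+|C|} P_K(λ_0 − σ(A) − σ(C)) = (−1)^{k(p−k) + k(q−p) + (p−k)(q−p+k)} · (p choose k). -/

import Mathlib

open Finset

/-- Product over a block `B` of indices of `(λ_i - λ_j)/(j - i)` over pairs `i < j` in `B`. -/
def blockProd (B : Finset ℕ) (lam : ℕ → ℚ) : ℚ :=
  ∏ i ∈ B, ∏ j ∈ B, if i < j then (lam i - lam j) / ((j : ℚ) - (i : ℚ)) else 1

/-- The Weyl dimension polynomial `P_K` for `K = S(U(p) × U(q))`: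
`P_K(λ) = ∏_{1≤i<j≤p} (λ_i−λ_j)/(j−i) · ∏_{p+1≤i<j≤p+q} (λ_i−λ_j)/(j−i)`. -/
def PK (p q : ℕ) (lam : ℕ → ℚ) : ℚ :=
  blockProd (Finset.Icc 1 p) lam * blockProd (Finset.Icc (p + 1) (p + q)) lam

/-- The Weyl dimension polynomial `P_{K∩L}`, a product over the five index blocks
`{1,…,k}`, `{k+1,…,p}`, `{p+1,…,2p−k}`, `{2p−k+1,…,p+q−k}`, `{p+q−k+1,…,p+q}`. -/
def PKL (p q k : ℕ) (lam : ℕ → ℚ) : ℚ :=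
  blockProd (Finset.Icc 1 k) lam * blockProd (Finset.Icc (k + 1) p) lam *
    blockProd (Finset.Icc (p + 1) (2 * p - k)) lam *
    blockProd (Finset.Icc (2 * p - k + 1) (p + q - k)) lam *
    blockProd (Finset.Icc (p + q - k + 1) (p + q)) lam

/-- The vector `e_i − e_j` in `ℚ^n` (indices written `1,…,n`). -/
def root (i j : ℕ) : ℕ → ℚ := fun t => (if t = i then (1 : ℚ) else 0) - (if t = j then 1 else 0)

/-- `σ(S) = ∑_{β ∈ S} β`, where the finite set `S` of vectors `e_i − e_j` is encoded by the
finite set of the corresponding pairs `(i, j)`. -/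
def sigmaSum (S : Finset (ℕ × ℕ)) : ℕ → ℚ := fun t => ∑ ij ∈ S, root ij.1 ij.2 t

/-- `Δ_n^+(𝔩) = {e_i − e_j : 1 ≤ i ≤ k, p+1 ≤ j ≤ 2p−k} ∪
{e_i − e_j : k+1 ≤ i ≤ p, p+q−k+1 ≤ j ≤ p+q}`, encoded by pairs of indices. -/
def DeltaNL (p q k : ℕ) : Finset (ℕ × ℕ) :=
  (Finset.Icc 1 k ×ˢ Finset.Icc (p + 1) (2 * p - k)) ∪
    (Finset.Icc (k + 1) p ×ˢ Finset.Icc (p + q - k + 1) (p + q))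

/-- `Δ(𝔭_1) = {e_i − e_j : 1 ≤ i ≤ k, 2p−k+1 ≤ j ≤ p+q−k} ∪
{e_i − e_j : 2p−k+1 ≤ i ≤ p+q−k, k+1 ≤ j ≤ p}`, encoded by pairs of indices. -/
def DeltaP1 (p q k : ℕ) : Finset (ℕ × ℕ) :=
  (Finset.Icc 1 k ×ˢ Finset.Icc (2 * p - k + 1) (p + q - k)) ∪
    (Finset.Icc (2 * p - k + 1) (p + q - k) ×ˢ Finset.Icc (k + 1) p)

/-- The special point
`λ_0 = (q, q−1, …, q−k+1, p, p−1, …, k+1 | p−k, …, 1, q−k, …, p−k+1, k, …, 1)`. -/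
def lam0 (p q k : ℕ) : ℕ → ℚ := fun t =>
  if t ≤ k then (q : ℚ) + 1 - t
  else if t ≤ p then (p : ℚ) + k + 1 - t
  else if t ≤ 2 * p - k then 2 * (p : ℚ) - k + 1 - t
  else if t ≤ p + q - k then (q : ℚ) + 2 * p - 2 * k + 1 - t
  else (p : ℚ) + q + 1 - t

/-- The alternating double sum
`∑_{A ⊆ Δ_n^+(𝔩)} ∑_{C ⊆ Δ(𝔭_1)} (−1)^{|A|+|C|} P_K(λ − σ(A) − σ(C))`. -/
def DSum (p q k : ℕ) (lam : ℕ → ℚ) : ℚ :=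
  ∑ A ∈ (DeltaNL p q k).powerset, ∑ C ∈ (DeltaP1 p q k).powerset,
    (-1 : ℚ) ^ (A.card + C.card) *
      PK p q (fun t => lam t - sigmaSum A t - sigmaSum C t)

/-- The Vandermonde product `∏_{i<j} (x_i - x_j)`. -/
def vdm {n : ℕ} (x : Fin n → ℚ) : ℚ := ∏ i, ∏ j, if i < j then x i - x j else 1

lemma vdm_eq_det {n : ℕ} (x : Fin n → ℚ) :
    vdm x = (Matrix.of fun i j : Fin n => x i ^ (n - 1 - (j : ℕ))).det := by
  have h : (Matrix.of fun i j : Fin n => x i ^ (n - 1 - (j : ℕ))).submatrix Fin.revPerm Fin.revPerm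
      = Matrix.vandermonde (fun i => x (Fin.rev i)) := by
    ext i j
    simp only [Matrix.submatrix_apply, Matrix.of_apply, Fin.revPerm_apply, Matrix.vandermonde_apply,
      Fin.val_rev]
    congr 1
    omega
  rw [← Matrix.det_submatrix_equiv_self Fin.revPerm, h, Matrix.det_vandermonde, vdm,
    ← Equiv.prod_comp Fin.revPerm, Finset.prod_congr rfl fun i _ =>
      (Equiv.prod_comp Fin.revPerm (fun j => if Fin.revPerm i < j then
        x (Fin.revPerm i) - x j else 1)).symm, Finset.prod_comm]
  refine Finset.prod_congr rfl fun i _ => ?_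
  simp only [Fin.revPerm_apply, Fin.rev_lt_rev]
  rw [← Finset.prod_filter]
  refine Finset.prod_congr ?_ fun _ _ => rfl
  ext j
  simp

lemma vdm_comp_perm {n : ℕ} (x : Fin n → ℚ) (g : Equiv.Perm (Fin n)) :
    vdm (x ∘ g) = (Equiv.Perm.sign g : ℤ) * vdm x := by
  rw [vdm_eq_det, vdm_eq_det, ← Matrix.det_permute]
  rfl

lemma vdm_comp_equiv_perm {ι : Type*} [Fintype ι] [DecidableEq ι] {n : ℕ} (e : ι ≃ Fin n)
    (x : ι → ℚ) (g : Equiv.Perm ι) :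
    vdm ((x ∘ g) ∘ e.symm) = (Equiv.Perm.sign g : ℤ) * vdm (x ∘ e.symm) := by
  rw [← Equiv.Perm.sign_permCongr e g, ← vdm_comp_perm]
  congr 1
  ext i
  simp [Equiv.permCongr_apply]

lemma vdm_ne_zero {n : ℕ} {x : Fin n → ℚ} (hx : Function.Injective x) : vdm x ≠ 0 := by
  unfold vdm
  refine Finset.prod_ne_zero_iff.2 fun i _ => Finset.prod_ne_zero_iff.2 fun j _ => ?_
  split_ifs with h
  · exact sub_ne_zero.2 fun hij => h.ne (hx hij)
  · exact one_ne_zero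

lemma vdm_append {a c : ℕ} (x : Fin a ⊕ Fin c → ℚ) :
    vdm (x ∘ finSumFinEquiv.symm) = vdm (x ∘ Sum.inl) * vdm (x ∘ Sum.inr) *
      ∏ i : Fin a, ∏ j : Fin c, (x (Sum.inl i) - x (Sum.inr j)) := by
  have h1 : ∀ (i : Fin a) (j : Fin c), Fin.castAdd c i < Fin.natAdd a j := fun i j => by
    rw [Fin.lt_def]; simp; omega
  have h2 : ∀ (i : Fin a) (j : Fin c), ¬ Fin.natAdd a j < Fin.castAdd c i := fun i j =>
    (h1 i j).le.not_gt
  have hN : ∀ i j : Fin c, Fin.natAdd a i < Fin.natAdd a j ↔ i < j := fun i j => by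
    simp only [Fin.lt_def, Fin.val_natAdd]; omega
  have hC : ∀ i j : Fin a, Fin.castAdd c i < Fin.castAdd c j ↔ i < j := fun i j => by
    simp only [Fin.lt_def, Fin.val_castAdd]
  unfold vdm
  rw [Fin.prod_univ_add]
  simp only [Fin.prod_univ_add, Function.comp_apply, finSumFinEquiv_symm_apply_castAdd,
    finSumFinEquiv_symm_apply_natAdd, h1, h2, if_true, if_false, Finset.prod_const_one, one_mul,
    Finset.prod_mul_distrib, hN, hC]
  ring

lemma sum_range_add_card_sdiff_le (s : Finset ℕ) :
    ∑ i ∈ range #s, i + #(s \ range #s) ≤ ∑ i ∈ s, i := by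
  have hc : #(s \ range #s) = #(range #s \ s) :=
    Finset.card_sdiff_comm (by simp)
  have h1 : #(s \ range #s) * #s ≤ ∑ i ∈ s \ range #s, i := by
    rw [← smul_eq_mul]
    refine Finset.card_nsmul_le_sum _ _ _ fun i hi => ?_
    simp only [mem_sdiff, mem_range, not_lt] at hi
    exact hi.2
  have h2 : ∑ i ∈ range #s \ s, (i + 1) ≤ #(range #s \ s) * #s := by
    rw [← smul_eq_mul]
    refine Finset.sum_le_card_nsmul _ _ _ fun i hi => ?_
    simp only [mem_sdiff, mem_range] at hi
    exact hi.1
  rw [Finset.sum_add_distrib, Finset.sum_const, smul_eq_mul, mul_one, ← hc] at h2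
  have h3 := Finset.sum_inter_add_sum_sdiff s (range #s) (fun i => i)
  have h4 := Finset.sum_inter_add_sum_sdiff (range #s) s (fun i => i)
  rw [Finset.inter_comm] at h4
  omega

lemma sum_range_le_sum_of_injective {n : ℕ} {mu : Fin n → ℕ} (hmu : Function.Injective mu) :
    ∑ i ∈ range n, i ≤ ∑ i, mu i := by
  have h := sum_range_add_card_sdiff_le (univ.image mu)
  rw [Finset.card_image_of_injective _ hmu, Finset.card_fin,
    Finset.sum_image (hmu.injOn)] at h
  omega

lemma exists_perm_of_sum_eq {n : ℕ} {mu : Fin n → ℕ} (hmu : Function.Injective mu)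
    (hs : ∑ i, mu i = ∑ i ∈ range n, i) :
    ∃ g : Equiv.Perm (Fin n), ∀ i, mu i = n - 1 - (g i : ℕ) := by
  have h := sum_range_add_card_sdiff_le (univ.image mu)
  rw [Finset.card_image_of_injective _ hmu, Finset.card_fin,
    Finset.sum_image (hmu.injOn), hs] at h
  have h0 : univ.image mu \ range n = ∅ := Finset.card_eq_zero.1 (by omega)
  have hlt : ∀ i, mu i < n := fun i => by
    have := Finset.sdiff_eq_empty_iff_subset.1 h0 (Finset.mem_image_of_mem mu (mem_univ i))
    simpa using this
  have hinj : Function.Injective fun i => Fin.rev (⟨mu i, hlt i⟩ : Fin n) := fun i j hij => by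
    have := Fin.rev_injective hij
    exact hmu (by simpa using this)
  refine ⟨Equiv.ofBijective _ (Finite.injective_iff_bijective.1 hinj), fun i => ?_⟩
  have := hlt i
  simp only [Equiv.ofBijective_apply, Fin.val_rev]
  omega

/-- The normalized difference product of a tuple of exponents. -/
def diffProd {n : ℕ} (mu : Fin n → ℕ) : ℚ :=
  ∏ i, ∏ j, if i < j then ((mu i : ℚ) - mu j) / (((j : ℕ) : ℚ) - (i : ℕ)) else 1

lemma diffProd_eq {n : ℕ} (mu : Fin n → ℕ) :
    diffProd mu = vdm (fun i => (mu i : ℚ)) / vdm (fun i : Fin n => ((n - 1 - (i : ℕ) : ℕ) : ℚ)) := by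
  unfold diffProd vdm
  simp only [← Finset.prod_div_distrib]
  refine Finset.prod_congr rfl fun i _ => Finset.prod_congr rfl fun j _ => ?_
  split_ifs with h
  · congr 1
    rw [show n - 1 - (i : ℕ) = (n - 1 - (j : ℕ)) + ((j : ℕ) - (i : ℕ)) by omega]
    rw [Fin.lt_def] at h
    push_cast [h.le]
    ring
  · simp

lemma diffProd_mul_vdm_of_perm {n : ℕ} {mu : Fin n → ℕ} {g : Equiv.Perm (Fin n)}
    (hg : ∀ i, mu i = n - 1 - (g i : ℕ)) (x : Fin n → ℚ) :
    diffProd mu * vdm x = (Matrix.of fun i j => x i ^ mu j).det := by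
  have hd : vdm (fun i : Fin n => ((n - 1 - (i : ℕ) : ℕ) : ℚ)) ≠ 0 := vdm_ne_zero fun i j hij => by
    have : n - 1 - (i : ℕ) = n - 1 - (j : ℕ) := by exact_mod_cast hij
    omega
  have h1 : diffProd mu = (Equiv.Perm.sign g : ℤ) := by
    rw [diffProd_eq, div_eq_iff hd, ← vdm_comp_perm]
    congr 1
    ext i
    simp [hg]
  rw [h1, vdm_eq_det, ← Matrix.det_permute']
  congr 1
  ext i j
  simp [hg]

lemma diffProd_eq_zero {n : ℕ} {mu : Fin n → ℕ} (hmu : ¬ Function.Injective mu) :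
    diffProd mu = 0 := by
  rw [Function.not_injective_iff] at hmu
  obtain ⟨i, j, hij, hne⟩ := hmu
  wlog h : i < j generalizing i j
  · exact this j i hij.symm hne.symm (lt_of_le_of_ne (not_lt.1 h) hne.symm)
  unfold diffProd
  refine Finset.prod_eq_zero (mem_univ i) (Finset.prod_eq_zero (mem_univ j) ?_)
  simp [h, hij]

lemma det_pow_eq_zero {n : ℕ} {mu : Fin n → ℕ} (hmu : ¬ Function.Injective mu) (x : Fin n → ℚ) :
    (Matrix.of fun i j => x i ^ mu j).det = 0 := by
  rw [Function.not_injective_iff] at hmu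
  obtain ⟨i, j, hij, hne⟩ := hmu
  exact Matrix.det_zero_of_column_eq hne fun l => by simp [hij]

lemma diffProd_mul_diffProd {a c : ℕ} (mu : Fin a → ℕ) (nu : Fin c → ℕ)
    (hs : ∑ i, mu i + ∑ i, nu i = ∑ i ∈ range a, i + ∑ i ∈ range c, i)
    (x : Fin a → ℚ) (y : Fin c → ℚ) :
    diffProd mu * diffProd nu * (vdm x * vdm y) =
      (Matrix.of fun i j => x i ^ mu j).det * (Matrix.of fun i j => y i ^ nu j).det := by
  by_cases hmu : Function.Injective mu
  · by_cases hnu : Function.Injective nu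
    · have h1 := sum_range_le_sum_of_injective hmu
      have h2 := sum_range_le_sum_of_injective hnu
      obtain ⟨g, hg⟩ := exists_perm_of_sum_eq hmu (by omega)
      obtain ⟨h, hh⟩ := exists_perm_of_sum_eq hnu (by omega)
      rw [← diffProd_mul_vdm_of_perm hg, ← diffProd_mul_vdm_of_perm hh]
      ring
    · rw [diffProd_eq_zero hnu, det_pow_eq_zero hnu]
      ring
  · rw [diffProd_eq_zero hmu, det_pow_eq_zero hmu]
    ring

@[to_additive]
lemma prod_Icc_add_eq_prod_fin {M : Type*} [CommMonoid M] (s n : ℕ) (F : ℕ → M) :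
    ∏ t ∈ Icc (s + 1) (s + n), F t = ∏ i : Fin n, F (s + 1 + i) := by
  rw [Fin.prod_univ_eq_prod_range (fun i => F (s + 1 + i)) n,
    show Icc (s + 1) (s + n) = Ico (s + 1) (s + n + 1) by ext; simp,
    Finset.prod_Ico_eq_prod_range, show s + n + 1 - (s + 1) = n by omega]

@[to_additive]
lemma prod_product_Icc_add {M : Type*} [CommMonoid M] (s n r l : ℕ) (F : ℕ × ℕ → M) :
    ∏ t ∈ Icc (s + 1) (s + n) ×ˢ Icc (r + 1) (r + l), F t =
      ∏ i : Fin n, ∏ j : Fin l, F (s + 1 + i, r + 1 + j) := by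
  rw [Finset.prod_product, prod_Icc_add_eq_prod_fin]
  exact Finset.prod_congr rfl fun i _ => prod_Icc_add_eq_prod_fin r l _

@[to_additive]
lemma prod_DeltaNL {M : Type*} [CommMonoid M] (k b m : ℕ) (F : ℕ × ℕ → M) :
    ∏ t ∈ DeltaNL (k + b) (k + b + m) k, F t =
      (∏ i : Fin k, ∏ j : Fin b, F (0 + 1 + i, k + b + 1 + j)) *
        ∏ i : Fin b, ∏ j : Fin k, F (k + 1 + i, k + 2 * b + m + 1 + j) := by
  rw [DeltaNL, Finset.prod_union]
  · rw [← prod_product_Icc_add, ← prod_product_Icc_add,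
      show 2 * (k + b) - k = k + b + b by omega,
      show k + b + (k + b + m) - k = k + 2 * b + m by omega,
      show k + b + (k + b + m) = k + 2 * b + m + k by omega, zero_add, zero_add]
  · rw [Finset.disjoint_left]
    rintro ⟨i, j⟩ h1 h2
    simp only [mem_product, mem_Icc] at h1 h2
    omega

@[to_additive]
lemma prod_DeltaP1 {M : Type*} [CommMonoid M] (k b m : ℕ) (F : ℕ × ℕ → M) :
    ∏ t ∈ DeltaP1 (k + b) (k + b + m) k, F t =
      (∏ i : Fin k, ∏ j : Fin m, F (0 + 1 + i, k + 2 * b + 1 + j)) *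
        ∏ i : Fin m, ∏ j : Fin b, F (k + 2 * b + 1 + i, k + 1 + j) := by
  rw [DeltaP1, Finset.prod_union]
  · rw [← prod_product_Icc_add, ← prod_product_Icc_add,
      show 2 * (k + b) - k = k + 2 * b by omega,
      show k + b + (k + b + m) - k = k + 2 * b + m by omega, zero_add, zero_add]
  · rw [Finset.disjoint_left]
    rintro ⟨i, j⟩ h1 h2
    simp only [mem_product, mem_Icc] at h1 h2
    omega

@[to_additive]
lemma prod_Icc_blocks {M : Type*} [CommMonoid M] (k b m : ℕ) (F : ℕ → M) :
    ∏ t ∈ Icc 1 (k + b + (k + b + m)), F t =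
      (∏ i : Fin k, F (0 + 1 + i)) * (∏ i : Fin b, F (k + 1 + i)) *
        ((∏ i : Fin b, F (k + b + 1 + i)) * ((∏ i : Fin m, F (k + 2 * b + 1 + i)) *
          ∏ i : Fin k, F (k + 2 * b + m + 1 + i))) := by
  have h := prod_Icc_add_eq_prod_fin 0 ((k + b) + (b + (m + k))) F
  rw [show 0 + ((k + b) + (b + (m + k))) = k + b + (k + b + m) by omega, zero_add] at h
  rw [h]
  simp only [Fin.prod_univ_add, Fin.val_castAdd, Fin.val_natAdd]
  refine congrArg₂ (· * ·) (congrArg₂ (· * ·) ?_ ?_)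
    (congrArg₂ (· * ·) ?_ (congrArg₂ (· * ·) ?_ ?_)) <;>
  exact Finset.prod_congr rfl fun i _ => congrArg F (by omega)

lemma blockProd_eq_diffProd (s n : ℕ) (lam : ℕ → ℚ) (mu : Fin n → ℕ) (c : ℚ)
    (h : ∀ i : Fin n, lam (s + 1 + i) = mu i + c) :
    blockProd (Icc (s + 1) (s + n)) lam = diffProd mu := by
  unfold blockProd diffProd
  rw [prod_Icc_add_eq_prod_fin]
  refine Finset.prod_congr rfl fun i _ => ?_
  rw [prod_Icc_add_eq_prod_fin]
  refine Finset.prod_congr rfl fun j _ => ?_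
  rw [h, h]
  by_cases hij : i < j
  · rw [if_pos hij, if_pos (by simpa using hij)]
    push_cast
    congr 1 <;> ring
  · rw [if_neg hij, if_neg (by simpa using hij)]

/-- The staircase exponents inside each of the five blocks. -/
def stair (k b m t : ℕ) : ℕ :=
  if t ≤ k then k - t
  else if t ≤ k + b then k + b - t
  else if t ≤ k + 2 * b then k + 2 * b - t
  else if t ≤ k + 2 * b + m then k + 2 * b + m - t
  else 2 * k + 2 * b + m - t

/-- The number of pairs of `S` that `f` sends to `t`. -/
def fiberCard (f : ℕ × ℕ → ℕ) (S : Finset (ℕ × ℕ)) (t : ℕ) : ℕ :=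
  ∑ ij ∈ S, if f ij = t then 1 else 0

lemma prod_pow_fiberCard {f : ℕ × ℕ → ℕ} {S : Finset (ℕ × ℕ)} {T : Finset ℕ}
    (h : ∀ ij ∈ S, f ij ∈ T) (z : ℕ → ℚ) :
    ∏ t ∈ T, z t ^ fiberCard f S t = ∏ ij ∈ S, z (f ij) := by
  simp only [fiberCard, ← Finset.prod_pow_eq_pow_sum]
  rw [Finset.prod_comm]
  refine Finset.prod_congr rfl fun ij hij => ?_
  simp [pow_ite, Finset.prod_ite_eq, h ij hij]

lemma sum_fiberCard {f : ℕ × ℕ → ℕ} {S : Finset (ℕ × ℕ)} {T : Finset ℕ}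
    (h : ∀ ij ∈ S, f ij ∈ T) : ∑ t ∈ T, fiberCard f S t = #S := by
  unfold fiberCard
  rw [Finset.sum_comm, Finset.card_eq_sum_ones]
  refine Finset.sum_congr rfl fun ij hij => ?_
  simp [h ij hij]

/-- The exponent contributed by choosing the subset `S` in the expansion of
`∏_{(i, j) ∈ D} (z_i - z_j)`. -/
def choiceExp (D S : Finset (ℕ × ℕ)) (t : ℕ) : ℕ :=
  fiberCard Prod.snd S t + fiberCard Prod.fst (D \ S) t

lemma choiceExp_cast {D S : Finset (ℕ × ℕ)} (h : S ⊆ D) (t : ℕ) :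
    (choiceExp D S t : ℚ) = fiberCard Prod.fst D t - sigmaSum S t := by
  have h1 : fiberCard Prod.fst D t = fiberCard Prod.fst (D \ S) t + fiberCard Prod.fst S t :=
    (Finset.sum_sdiff h).symm
  have h2 : sigmaSum S t = (fiberCard Prod.fst S t : ℚ) - fiberCard Prod.snd S t := by
    simp only [sigmaSum, root, fiberCard, Finset.sum_sub_distrib, eq_comm (a := t)]
    push_cast
    rfl
  rw [h1, h2, choiceExp]
  push_cast
  ring

lemma prod_pow_choiceExp {D S : Finset (ℕ × ℕ)} {T : Finset ℕ} (h : S ⊆ D)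
    (h1 : ∀ ij ∈ D, ij.1 ∈ T) (h2 : ∀ ij ∈ D, ij.2 ∈ T) (z : ℕ → ℚ) :
    ∏ t ∈ T, z t ^ choiceExp D S t = (∏ ij ∈ D \ S, z ij.1) * ∏ ij ∈ S, z ij.2 := by
  simp only [choiceExp, pow_add, Finset.prod_mul_distrib]
  rw [prod_pow_fiberCard (fun ij hij => h2 ij (h hij)),
    prod_pow_fiberCard (fun ij hij => h1 ij (Finset.sdiff_subset hij)), mul_comm]

lemma sum_choiceExp {D S : Finset (ℕ × ℕ)} {T : Finset ℕ} (h : S ⊆ D)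
    (h1 : ∀ ij ∈ D, ij.1 ∈ T) (h2 : ∀ ij ∈ D, ij.2 ∈ T) :
    ∑ t ∈ T, choiceExp D S t = #D := by
  simp only [choiceExp, Finset.sum_add_distrib]
  rw [sum_fiberCard (fun ij hij => h2 ij (h hij)),
    sum_fiberCard (fun ij hij => h1 ij (Finset.sdiff_subset hij)), add_comm,
    Finset.card_sdiff_add_card_eq_card h]

lemma sum_prod_pow_choiceExp {D : Finset (ℕ × ℕ)} {T : Finset ℕ}
    (h1 : ∀ ij ∈ D, ij.1 ∈ T) (h2 : ∀ ij ∈ D, ij.2 ∈ T) (z : ℕ → ℚ) :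
    ∑ S ∈ D.powerset, (-1) ^ #S * ∏ t ∈ T, z t ^ choiceExp D S t =
      ∏ ij ∈ D, (z ij.1 - z ij.2) := by
  rw [Finset.prod_sub]
  refine Finset.sum_congr rfl fun S hS => ?_
  rw [prod_pow_choiceExp (Finset.mem_powerset.1 hS) h1 h2]
  ring

lemma mem_Icc_of_mem_DeltaNL {k b m : ℕ} {ij : ℕ × ℕ} (h : ij ∈ DeltaNL (k + b) (k + b + m) k) :
    ij.1 ∈ Icc 1 (k + b + (k + b + m)) ∧ ij.2 ∈ Icc 1 (k + b + (k + b + m)) := by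
  simp only [DeltaNL, mem_union, mem_product, mem_Icc] at h ⊢
  omega

lemma mem_Icc_of_mem_DeltaP1 {k b m : ℕ} {ij : ℕ × ℕ} (h : ij ∈ DeltaP1 (k + b) (k + b + m) k) :
    ij.1 ∈ Icc 1 (k + b + (k + b + m)) ∧ ij.2 ∈ Icc 1 (k + b + (k + b + m)) := by
  simp only [DeltaP1, mem_union, mem_product, mem_Icc] at h ⊢
  omega

/-- The exponent vector of the term of the double sum indexed by `A` and `C`. -/
def termExp (k b m : ℕ) (A C : Finset (ℕ × ℕ)) (t : ℕ) : ℕ :=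
  stair k b m t + choiceExp (DeltaNL (k + b) (k + b + m) k) A t +
    choiceExp (DeltaP1 (k + b) (k + b + m) k) C t

lemma fiberCard_fst_product (I J : Finset ℕ) (t : ℕ) :
    fiberCard Prod.fst (I ×ˢ J) t = if t ∈ I then #J else 0 := by
  rw [fiberCard, Finset.sum_product]
  have h : ∀ x, (∑ y ∈ J, if (x, y).1 = t then 1 else 0) = if x = t then #J else 0 := fun x => by
    split_ifs <;> simp
  simp only [h, Finset.sum_ite_eq']

lemma lam0_eq (k b m t : ℕ) (h0 : 1 ≤ t) (h1 : t ≤ k + b + (k + b + m)) :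
    lam0 (k + b) (k + b + m) k t = ((stair k b m t +
      fiberCard Prod.fst (DeltaNL (k + b) (k + b + m) k) t +
      fiberCard Prod.fst (DeltaP1 (k + b) (k + b + m) k) t : ℕ) : ℚ) + 1 := by
  have hNL : fiberCard Prod.fst (DeltaNL (k + b) (k + b + m) k) t =
      (if t ∈ Icc 1 k then b else 0) + if t ∈ Icc (k + 1) (k + b) then k else 0 := by
    rw [fiberCard, DeltaNL, Finset.sum_union]
    · have := fiberCard_fst_product (Icc 1 k) (Icc (k + b + 1) (2 * (k + b) - k)) t
      have h2 := fiberCard_fst_product (Icc (k + 1) (k + b))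
        (Icc (k + b + (k + b + m) - k + 1) (k + b + (k + b + m))) t
      unfold fiberCard at this h2
      rw [this, h2, Nat.card_Icc, Nat.card_Icc]
      congr 2 <;> omega
    · rw [Finset.disjoint_left]
      rintro ⟨i, j⟩ h1 h2
      simp only [mem_product, mem_Icc] at h1 h2
      omega
  have hP1 : fiberCard Prod.fst (DeltaP1 (k + b) (k + b + m) k) t =
      (if t ∈ Icc 1 k then m else 0) +
        if t ∈ Icc (k + 2 * b + 1) (k + 2 * b + m) then b else 0 := by
    rw [fiberCard, DeltaP1, Finset.sum_union]
    · have := fiberCard_fst_product (Icc 1 k)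
        (Icc (2 * (k + b) - k + 1) (k + b + (k + b + m) - k)) t
      have h2 := fiberCard_fst_product (Icc (2 * (k + b) - k + 1) (k + b + (k + b + m) - k))
        (Icc (k + 1) (k + b)) t
      unfold fiberCard at this h2
      rw [this, h2, Nat.card_Icc, Nat.card_Icc,
        show 2 * (k + b) - k = k + 2 * b by omega,
        show k + b + (k + b + m) - k = k + 2 * b + m by omega]
      congr 2 <;> omega
    · rw [Finset.disjoint_left]
      rintro ⟨i, j⟩ h1 h2
      simp only [mem_product, mem_Icc] at h1 h2
      omega
  rw [hNL, hP1]
  simp only [mem_Icc]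
  unfold lam0 stair
  rw [show 2 * (k + b) - k = k + 2 * b by omega,
    show k + b + (k + b + m) - k = k + 2 * b + m by omega]
  have h2 : t ≤ 2 * k + 2 * b + m := by omega
  split_ifs <;> first
    | omega
    | (push_cast [*]; ring)

lemma lam0_sub_eq {k b m : ℕ} {A C : Finset (ℕ × ℕ)} (hA : A ⊆ DeltaNL (k + b) (k + b + m) k)
    (hC : C ⊆ DeltaP1 (k + b) (k + b + m) k) {t : ℕ} (h0 : 1 ≤ t)
    (h1 : t ≤ k + b + (k + b + m)) :
    lam0 (k + b) (k + b + m) k t - sigmaSum A t - sigmaSum C t =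
      (termExp k b m A C t : ℚ) + 1 := by
  rw [lam0_eq k b m t h0 h1, termExp]
  push_cast
  rw [choiceExp_cast hA, choiceExp_cast hC]
  ring

lemma sum_fin_reverse (n : ℕ) : ∑ i : Fin n, (n - 1 - (i : ℕ)) = ∑ i ∈ range n, i := by
  rw [Fin.sum_univ_eq_sum_range (fun i => n - 1 - i) n]
  exact Finset.sum_range_reflect (fun i => i) n

lemma sum_range_id_add (a c : ℕ) :
    ∑ i ∈ range (a + c), i = ∑ i ∈ range a, i + ∑ i ∈ range c, i + a * c := by
  rw [Finset.sum_range_add, Finset.sum_add_distrib, Finset.sum_const, card_range, smul_eq_mul]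
  ring

lemma stair_block_one {k b m : ℕ} (i : Fin k) : stair k b m (0 + 1 + i) = k - 1 - i := by
  unfold stair; split_ifs <;> omega

lemma stair_block_two {k b m : ℕ} (i : Fin b) : stair k b m (k + 1 + i) = b - 1 - i := by
  unfold stair; split_ifs <;> omega

lemma stair_block_three {k b m : ℕ} (i : Fin b) : stair k b m (k + b + 1 + i) = b - 1 - i := by
  unfold stair; split_ifs <;> omega

lemma stair_block_four {k b m : ℕ} (i : Fin m) : stair k b m (k + 2 * b + 1 + i) = m - 1 - i := by
  unfold stair; split_ifs <;> omega

lemma stair_block_five {k b m : ℕ} (i : Fin k) :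
    stair k b m (k + 2 * b + m + 1 + i) = k - 1 - i := by
  unfold stair; split_ifs <;> omega

lemma sum_termExp {k b m : ℕ} {A C : Finset (ℕ × ℕ)} (hA : A ⊆ DeltaNL (k + b) (k + b + m) k)
    (hC : C ⊆ DeltaP1 (k + b) (k + b + m) k) :
    ∑ t ∈ Icc 1 (k + b + (k + b + m)), termExp k b m A C t =
      ∑ i ∈ range (k + b), i + ∑ i ∈ range (b + (m + k)), i := by
  simp only [termExp, Finset.sum_add_distrib]
  rw [sum_choiceExp hA (fun _ h => (mem_Icc_of_mem_DeltaNL h).1)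
      (fun _ h => (mem_Icc_of_mem_DeltaNL h).2),
    sum_choiceExp hC (fun _ h => (mem_Icc_of_mem_DeltaP1 h).1)
      (fun _ h => (mem_Icc_of_mem_DeltaP1 h).2), sum_Icc_blocks,
    Finset.card_eq_sum_ones, Finset.card_eq_sum_ones, sum_DeltaNL, sum_DeltaP1]
  simp only [stair_block_one, stair_block_two, stair_block_three, stair_block_four,
    stair_block_five, sum_fin_reverse, sum_range_id_add, Finset.sum_const, Finset.card_fin,
    smul_eq_mul, mul_one]
  ring

lemma PK_term {k b m : ℕ} {A C : Finset (ℕ × ℕ)} (hA : A ⊆ DeltaNL (k + b) (k + b + m) k)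
    (hC : C ⊆ DeltaP1 (k + b) (k + b + m) k) :
    PK (k + b) (k + b + m)
        (fun t => lam0 (k + b) (k + b + m) k t - sigmaSum A t - sigmaSum C t) =
      diffProd (fun i : Fin (k + b) => termExp k b m A C (0 + 1 + i)) *
        diffProd (fun i : Fin (b + (m + k)) => termExp k b m A C (k + b + 1 + i)) := by
  unfold PK
  congr 1
  · have := blockProd_eq_diffProd 0 (k + b)
      (fun t => lam0 (k + b) (k + b + m) k t - sigmaSum A t - sigmaSum C t)
      (fun i : Fin (k + b) => termExp k b m A C (0 + 1 + i)) 1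
      (fun i => lam0_sub_eq hA hC (by omega) (by omega))
    rw [← this, zero_add, zero_add]
  · rw [show k + b + (k + b + m) = k + b + (b + (m + k)) by omega]
    exact blockProd_eq_diffProd (k + b) (b + (m + k)) _ _ 1
      (fun i => lam0_sub_eq hA hC (by omega) (by omega))

/-- Consecutive numbering of three blocks. -/
def tripleEquiv (b m k : ℕ) : Fin b ⊕ (Fin m ⊕ Fin k) ≃ Fin (b + (m + k)) :=
  (Equiv.sumCongr (Equiv.refl _) finSumFinEquiv).trans finSumFinEquiv

/-- The Vandermonde product on two blocks. -/
def vdmTwo {k b : ℕ} (x : Fin k ⊕ Fin b → ℚ) : ℚ := vdm (x ∘ finSumFinEquiv.symm)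

/-- The Vandermonde product on three blocks. -/
def vdmThree {b m k : ℕ} (y : Fin b ⊕ (Fin m ⊕ Fin k) → ℚ) : ℚ :=
  vdm (y ∘ (tripleEquiv b m k).symm)

lemma vdmTwo_eq {k b : ℕ} (x : Fin k ⊕ Fin b → ℚ) :
    vdmTwo x = vdm (x ∘ Sum.inl) * vdm (x ∘ Sum.inr) *
      ∏ i : Fin k, ∏ j : Fin b, (x (Sum.inl i) - x (Sum.inr j)) := vdm_append x

lemma vdmThree_eq {b m k : ℕ} (y : Fin b ⊕ (Fin m ⊕ Fin k) → ℚ) :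
    vdmThree y = vdm (y ∘ Sum.inl) * (vdm (y ∘ Sum.inr ∘ Sum.inl) * vdm (y ∘ Sum.inr ∘ Sum.inr) *
      ∏ i : Fin m, ∏ j : Fin k, (y (Sum.inr (Sum.inl i)) - y (Sum.inr (Sum.inr j)))) *
      ((∏ i : Fin b, ∏ j : Fin m, (y (Sum.inl i) - y (Sum.inr (Sum.inl j)))) *
        ∏ i : Fin b, ∏ j : Fin k, (y (Sum.inl i) - y (Sum.inr (Sum.inr j)))) := by
  have h := vdm_append (y ∘ Sum.map id (finSumFinEquiv (m := m) (n := k)).symm)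
  have h2 := vdm_append (y ∘ Sum.inr)
  have h3 : y ∘ (tripleEquiv b m k).symm =
      (y ∘ Sum.map id (finSumFinEquiv (m := m) (n := k)).symm) ∘ finSumFinEquiv.symm := rfl
  rw [vdmThree, h3, h]
  change vdm (y ∘ Sum.inl) * vdm ((y ∘ Sum.inr) ∘ finSumFinEquiv.symm) * _ = _
  rw [h2]
  simp only [Fin.prod_univ_add, Function.comp_apply, Sum.map_inl, Sum.map_inr, id,
    finSumFinEquiv_symm_apply_castAdd, finSumFinEquiv_symm_apply_natAdd, Finset.prod_mul_distrib]
  rfl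

lemma vdmTwo_comp_perm {k b : ℕ} (x : Fin k ⊕ Fin b → ℚ) (g : Equiv.Perm (Fin k ⊕ Fin b)) :
    vdmTwo (x ∘ g) = (Equiv.Perm.sign g : ℤ) * vdmTwo x := vdm_comp_equiv_perm _ x g

lemma vdmThree_comp_perm {b m k : ℕ} (y : Fin b ⊕ (Fin m ⊕ Fin k) → ℚ)
    (h : Equiv.Perm (Fin b ⊕ (Fin m ⊕ Fin k))) :
    vdmThree (y ∘ h) = (Equiv.Perm.sign h : ℤ) * vdmThree y := vdm_comp_equiv_perm _ y h

/-- The staircase monomial `∏_i x_i^{n-1-i}`. -/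
def stairProd {n : ℕ} (x : Fin n → ℚ) : ℚ := ∏ i : Fin n, x i ^ (n - 1 - (i : ℕ))

/-- The product of `z_i - z_j` over the pairs of both root sets. -/
def rootProd {k b m : ℕ} (x : Fin k ⊕ Fin b → ℚ) (y : Fin b ⊕ (Fin m ⊕ Fin k) → ℚ) : ℚ :=
  ((∏ i : Fin k, ∏ j : Fin b, (x (Sum.inl i) - y (Sum.inl j))) *
    ∏ i : Fin b, ∏ j : Fin k, (x (Sum.inr i) - y (Sum.inr (Sum.inr j)))) *
  ((∏ i : Fin k, ∏ j : Fin m, (x (Sum.inl i) - y (Sum.inr (Sum.inl j)))) *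
    ∏ i : Fin m, ∏ j : Fin b, (y (Sum.inr (Sum.inl i)) - x (Sum.inr j)))

/-- The product of the staircase monomials of two blocks. -/
def stairTwo {k b : ℕ} (x : Fin k ⊕ Fin b → ℚ) : ℚ :=
  stairProd (x ∘ Sum.inl) * stairProd (x ∘ Sum.inr)

/-- The product of the staircase monomials of three blocks. -/
def stairThree {b m k : ℕ} (y : Fin b ⊕ (Fin m ⊕ Fin k) → ℚ) : ℚ :=
  stairProd (y ∘ Sum.inl) *
    (stairProd (y ∘ Sum.inr ∘ Sum.inl) * stairProd (y ∘ Sum.inr ∘ Sum.inr))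

/-- The positions of the first two blocks. -/
def posTwo (k b : ℕ) : Fin k ⊕ Fin b → ℕ :=
  Sum.elim (fun i => 0 + 1 + i) (fun i => k + 1 + i)

/-- The positions of the last three blocks. -/
def posThree (k b m : ℕ) : Fin b ⊕ (Fin m ⊕ Fin k) → ℕ :=
  Sum.elim (fun i => k + b + 1 + i)
    (Sum.elim (fun i => k + 2 * b + 1 + i) (fun i => k + 2 * b + m + 1 + i))

lemma posTwo_eq (k b : ℕ) (j : Fin k ⊕ Fin b) : posTwo k b j = 0 + 1 + finSumFinEquiv j := by
  rcases j with j | j <;> simp [posTwo]; omega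

lemma posThree_eq (k b m : ℕ) (j : Fin b ⊕ (Fin m ⊕ Fin k)) :
    posThree k b m j = k + b + 1 + tripleEquiv b m k j := by
  rcases j with j | j | j <;> simp [posThree, tripleEquiv] <;> omega

lemma exists_extension {k b m : ℕ} (x : Fin k ⊕ Fin b → ℚ)
    (y : Fin b ⊕ (Fin m ⊕ Fin k) → ℚ) :
    ∃ z : ℕ → ℚ, z ∘ posTwo k b = x ∧ z ∘ posThree k b m = y := by
  have hinj : Function.Injective (Sum.elim (posTwo k b) (posThree k b m)) := by
    rintro ((i | i) | (i | i | i)) ((j | j) | (j | j | j)) h <;>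
      simp only [Sum.elim_inl, Sum.elim_inr, posTwo, posThree] at h <;> first
      | omega
      | (congr; omega)
  refine ⟨Function.extend (Sum.elim (posTwo k b) (posThree k b m)) (Sum.elim x y) 0, ?_, ?_⟩
  · ext i
    exact hinj.extend_apply (Sum.elim x y) 0 (Sum.inl i)
  · ext i
    exact hinj.extend_apply (Sum.elim x y) 0 (Sum.inr i)

lemma prod_Icc_eq_posTwo_mul_posThree {M : Type*} [CommMonoid M] (k b m : ℕ) (F : ℕ → M) :
    ∏ t ∈ Icc 1 (k + b + (k + b + m)), F t =
      (∏ j, F (posTwo k b j)) * ∏ j, F (posThree k b m j) := by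
  rw [prod_Icc_blocks]
  simp only [Fintype.prod_sum_type, posTwo, posThree, Sum.elim_inl, Sum.elim_inr]

lemma sum_sum_prod_pow_termExp {k b m : ℕ} (z : ℕ → ℚ) :
    ∑ A ∈ (DeltaNL (k + b) (k + b + m) k).powerset,
      ∑ C ∈ (DeltaP1 (k + b) (k + b + m) k).powerset, (-1 : ℚ) ^ (#A + #C) *
        ∏ t ∈ Icc 1 (k + b + (k + b + m)), z t ^ termExp k b m A C t =
      stairTwo (z ∘ posTwo k b) * stairThree (z ∘ posThree k b m) *
        rootProd (z ∘ posTwo k b) (z ∘ posThree k b m) := by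
  have h1 : ∏ t ∈ Icc 1 (k + b + (k + b + m)), z t ^ stair k b m t =
      stairTwo (z ∘ posTwo k b) * stairThree (z ∘ posThree k b m) := by
    rw [prod_Icc_blocks]
    simp only [stair_block_one, stair_block_two, stair_block_three, stair_block_four,
      stair_block_five]
    rfl
  have h2 : (∏ ij ∈ DeltaNL (k + b) (k + b + m) k, (z ij.1 - z ij.2)) *
      ∏ ij ∈ DeltaP1 (k + b) (k + b + m) k, (z ij.1 - z ij.2) =
      rootProd (z ∘ posTwo k b) (z ∘ posThree k b m) := by
    rw [prod_DeltaNL, prod_DeltaP1]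
    rfl
  rw [← h1, ← h2,
    ← sum_prod_pow_choiceExp (fun _ h => (mem_Icc_of_mem_DeltaNL h).1)
      (fun _ h => (mem_Icc_of_mem_DeltaNL h).2),
    ← sum_prod_pow_choiceExp (fun _ h => (mem_Icc_of_mem_DeltaP1 h).1)
      (fun _ h => (mem_Icc_of_mem_DeltaP1 h).2), Finset.sum_mul_sum, Finset.mul_sum]
  refine Finset.sum_congr rfl fun A _ => ?_
  rw [Finset.mul_sum]
  refine Finset.sum_congr rfl fun C _ => ?_
  simp only [termExp, pow_add, Finset.prod_mul_distrib]
  ring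

lemma det_pow_comp_equiv {ι : Type*} [Fintype ι] [DecidableEq ι] {n : ℕ} (e : ι ≃ Fin n)
    (x : ι → ℚ) (mu : Fin n → ℕ) :
    (Matrix.of fun i j => (x ∘ e.symm) i ^ mu j).det =
      ∑ g : Equiv.Perm ι, ((Equiv.Perm.sign g : ℤ) : ℚ) * ∏ j, (x ∘ g) j ^ mu (e j) := by
  rw [← Matrix.det_submatrix_equiv_self e, Matrix.det_apply']
  simp

lemma DSum_mul_vdm (k b m : ℕ) (x : Fin k ⊕ Fin b → ℚ) (y : Fin b ⊕ (Fin m ⊕ Fin k) → ℚ) :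
    DSum (k + b) (k + b + m) k (lam0 (k + b) (k + b + m) k) * (vdmTwo x * vdmThree y) =
      ∑ g : Equiv.Perm (Fin k ⊕ Fin b), ∑ h : Equiv.Perm (Fin b ⊕ (Fin m ⊕ Fin k)),
        ((Equiv.Perm.sign g : ℤ) : ℚ) * ((Equiv.Perm.sign h : ℤ) : ℚ) *
          (stairTwo (x ∘ g) * stairThree (y ∘ h) * rootProd (x ∘ g) (y ∘ h)) := by
  have key : ∀ A ∈ (DeltaNL (k + b) (k + b + m) k).powerset,
      ∀ C ∈ (DeltaP1 (k + b) (k + b + m) k).powerset,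
      PK (k + b) (k + b + m)
        (fun t => lam0 (k + b) (k + b + m) k t - sigmaSum A t - sigmaSum C t) *
        (vdmTwo x * vdmThree y) =
      ∑ g : Equiv.Perm (Fin k ⊕ Fin b), ∑ h : Equiv.Perm (Fin b ⊕ (Fin m ⊕ Fin k)),
        ((Equiv.Perm.sign g : ℤ) : ℚ) * ((Equiv.Perm.sign h : ℤ) : ℚ) *
          ((∏ j, (x ∘ g) j ^ termExp k b m A C (posTwo k b j)) *
            ∏ j, (y ∘ h) j ^ termExp k b m A C (posThree k b m j)) := by
    intro A hA C hC
    rw [Finset.mem_powerset] at hA hC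
    have hs := sum_termExp hA hC
    rw [show k + b + (k + b + m) = k + b + (b + (m + k)) by omega,
      show Icc 1 (k + b + (b + (m + k))) = Icc (0 + 1) (0 + (k + b + (b + (m + k)))) by simp,
      sum_Icc_add_eq_sum_fin, Fin.sum_univ_add] at hs
    simp only [Fin.val_castAdd, Fin.val_natAdd] at hs
    rw [PK_term hA hC, vdmTwo, vdmThree, diffProd_mul_diffProd, det_pow_comp_equiv,
      det_pow_comp_equiv, Finset.sum_mul_sum]
    · simp only [← posTwo_eq, ← posThree_eq]
      refine Finset.sum_congr rfl fun g _ => Finset.sum_congr rfl fun h _ => ?_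
      ring
    · rw [← hs]
      congr 1
      exact Finset.sum_congr rfl fun i _ => congrArg _ (by omega)
  have hD : DSum (k + b) (k + b + m) k (lam0 (k + b) (k + b + m) k) * (vdmTwo x * vdmThree y) =
      ∑ A ∈ (DeltaNL (k + b) (k + b + m) k).powerset,
        ∑ C ∈ (DeltaP1 (k + b) (k + b + m) k).powerset,
        ∑ g : Equiv.Perm (Fin k ⊕ Fin b), ∑ h : Equiv.Perm (Fin b ⊕ (Fin m ⊕ Fin k)),
        ((Equiv.Perm.sign g : ℤ) : ℚ) * ((Equiv.Perm.sign h : ℤ) : ℚ) * ((-1 : ℚ) ^ (#A + #C) *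
          ((∏ j, (x ∘ g) j ^ termExp k b m A C (posTwo k b j)) *
            ∏ j, (y ∘ h) j ^ termExp k b m A C (posThree k b m j))) := by
    rw [DSum, Finset.sum_mul]
    refine Finset.sum_congr rfl fun A hA => ?_
    rw [Finset.sum_mul]
    refine Finset.sum_congr rfl fun C hC => ?_
    rw [mul_assoc, key A hA C hC, Finset.mul_sum]
    refine Finset.sum_congr rfl fun g _ => ?_
    rw [Finset.mul_sum]
    refine Finset.sum_congr rfl fun h _ => ?_
    ring
  rw [hD, Finset.sum_congr rfl fun A _ => Finset.sum_comm, Finset.sum_comm]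
  refine Finset.sum_congr rfl fun g _ => ?_
  rw [Finset.sum_congr rfl fun A _ => Finset.sum_comm, Finset.sum_comm]
  refine Finset.sum_congr rfl fun h _ => ?_
  obtain ⟨z, hx, hy⟩ := exists_extension (x ∘ g) (y ∘ h)
  rw [← hx, ← hy, ← sum_sum_prod_pow_termExp, Finset.mul_sum]
  refine Finset.sum_congr rfl fun A _ => ?_
  rw [Finset.mul_sum]
  refine Finset.sum_congr rfl fun C _ => ?_
  rw [prod_Icc_eq_posTwo_mul_posThree]
  rfl

lemma sum_sign_mul_stairProd {n : ℕ} (x : Fin n → ℚ) :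
    ∑ g : Equiv.Perm (Fin n), ((Equiv.Perm.sign g : ℤ) : ℚ) * stairProd (x ∘ g) = vdm x := by
  rw [vdm_eq_det, Matrix.det_apply']
  rfl

/-- The product `∏ (x_i - x_j)` over `i` in the first block and `j` in the second. -/
def crossProd {k b : ℕ} (x : Fin k ⊕ Fin b → ℚ) : ℚ :=
  ∏ i : Fin k, ∏ j : Fin b, (x (Sum.inl i) - x (Sum.inr j))

lemma crossProd_comp_sumCongr {k b : ℕ} (x : Fin k ⊕ Fin b → ℚ) (a : Equiv.Perm (Fin k))
    (c : Equiv.Perm (Fin b)) : crossProd (x ∘ Equiv.sumCongr a c) = crossProd x := by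
  simp only [crossProd, Function.comp_apply, Equiv.sumCongr_apply, Sum.map_inl, Sum.map_inr]
  rw [Equiv.prod_comp a fun i => ∏ j, (x (Sum.inl i) - x (Sum.inr (c j)))]
  exact Finset.prod_congr rfl fun i _ => Equiv.prod_comp c fun j => x (Sum.inl i) - x (Sum.inr j)

lemma sum_sign_mul_stairTwo_sumCongr {k b : ℕ} (x : Fin k ⊕ Fin b → ℚ) :
    ∑ a : Equiv.Perm (Fin k), ∑ c : Equiv.Perm (Fin b),
      ((Equiv.Perm.sign (Equiv.sumCongr a c) : ℤ) : ℚ) * stairTwo (x ∘ Equiv.sumCongr a c) =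
        vdm (x ∘ Sum.inl) * vdm (x ∘ Sum.inr) := by
  rw [← sum_sign_mul_stairProd, ← sum_sign_mul_stairProd, Finset.sum_mul_sum]
  refine Finset.sum_congr rfl fun a _ => Finset.sum_congr rfl fun c _ => ?_
  rw [Equiv.Perm.sign_sumCongr]
  have h : stairTwo (x ∘ Equiv.sumCongr a c) =
      stairProd ((x ∘ Sum.inl) ∘ a) * stairProd ((x ∘ Sum.inr) ∘ c) := rfl
  rw [h]
  push_cast
  ring

lemma sum_sign_mul_stairTwo_mul_crossProd {k b : ℕ} (x : Fin k ⊕ Fin b → ℚ) :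
    ∑ g : Equiv.Perm (Fin k ⊕ Fin b),
      ((Equiv.Perm.sign g : ℤ) : ℚ) * (stairTwo (x ∘ g) * crossProd (x ∘ g)) =
        ((k + b).choose k : ℚ) * vdmTwo x := by
  set s := ∑ g : Equiv.Perm (Fin k ⊕ Fin b),
      ((Equiv.Perm.sign g : ℤ) : ℚ) * (stairTwo (x ∘ g) * crossProd (x ∘ g)) with hs
  have h1 : ∀ (a : Equiv.Perm (Fin k)) (c : Equiv.Perm (Fin b)),
      s = ∑ g : Equiv.Perm (Fin k ⊕ Fin b), ((Equiv.Perm.sign g : ℤ) : ℚ) * crossProd (x ∘ g) *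
        (((Equiv.Perm.sign (Equiv.sumCongr a c) : ℤ) : ℚ) *
          stairTwo ((x ∘ g) ∘ Equiv.sumCongr a c)) := by
    intro a c
    rw [hs, ← Equiv.sum_comp (Equiv.mulRight (Equiv.sumCongr a c : Equiv.Perm _))]
    refine Finset.sum_congr rfl fun g _ => ?_
    rw [Equiv.coe_mulRight, Equiv.Perm.sign_mul, Equiv.Perm.coe_mul, ← Function.comp_assoc,
      crossProd_comp_sumCongr]
    push_cast
    ring
  have h2 : (k.factorial : ℚ) * (b.factorial : ℚ) * s =
      ∑ a : Equiv.Perm (Fin k), ∑ c : Equiv.Perm (Fin b), s := by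
    simp [Fintype.card_perm, mul_assoc]
  have h3 : (k.factorial : ℚ) * (b.factorial : ℚ) * s = ((k + b).factorial : ℚ) * vdmTwo x := by
    rw [h2, Finset.sum_congr rfl fun a _ => Finset.sum_congr rfl fun c _ => h1 a c,
      Finset.sum_congr rfl fun a _ => Finset.sum_comm, Finset.sum_comm]
    simp only [← Finset.mul_sum]
    have h4 : ∀ g : Equiv.Perm (Fin k ⊕ Fin b), ((Equiv.Perm.sign g : ℤ) : ℚ) * crossProd (x ∘ g) *
        (∑ a : Equiv.Perm (Fin k), ∑ c : Equiv.Perm (Fin b),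
          ((Equiv.Perm.sign (Equiv.sumCongr a c) : ℤ) : ℚ) *
            stairTwo ((x ∘ g) ∘ Equiv.sumCongr a c)) = vdmTwo x := by
      intro g
      rw [sum_sign_mul_stairTwo_sumCongr, mul_assoc, mul_comm (crossProd _)]
      change _ * (vdm ((x ∘ g) ∘ Sum.inl) * vdm ((x ∘ g) ∘ Sum.inr) *
        ∏ i : Fin k, ∏ j : Fin b, ((x ∘ g) (Sum.inl i) - (x ∘ g) (Sum.inr j))) = _
      rw [← vdmTwo_eq, vdmTwo_comp_perm, ← mul_assoc, ← Int.cast_mul, ← Units.val_mul,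
        Int.units_mul_self]
      simp
    rw [Finset.sum_congr rfl fun g _ => h4 g]
    simp [Fintype.card_perm]
  have h5 : (((k + b).choose k * k.factorial * b.factorial : ℕ) : ℚ) = (k + b).factorial := by
    have h := Nat.choose_mul_factorial_mul_factorial (Nat.le_add_right k b)
    rw [Nat.add_sub_cancel_left] at h
    rw [h]
  have h6 : (k.factorial : ℚ) * (b.factorial : ℚ) ≠ 0 := by positivity
  refine mul_left_cancel₀ h6 ?_
  rw [h3, ← h5]
  push_cast
  ring

/-- The block permutation of three blocks. -/
def triplePerm {b m k : ℕ}
    (a : Equiv.Perm (Fin b) × Equiv.Perm (Fin m) × Equiv.Perm (Fin k)) :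
    Equiv.Perm (Fin b ⊕ (Fin m ⊕ Fin k)) :=
  Equiv.sumCongr a.1 (Equiv.sumCongr a.2.1 a.2.2)

lemma triplePerm_injective {b m k : ℕ} :
    Function.Injective (triplePerm (b := b) (m := m) (k := k)) := by
  rintro ⟨a1, a2, a3⟩ ⟨c1, c2, c3⟩ h
  have h' := fun t => DFunLike.congr_fun h t
  simp only [Prod.mk.injEq]
  refine ⟨Equiv.ext fun i => ?_, Equiv.ext fun i => ?_, Equiv.ext fun i => ?_⟩
  · simpa [triplePerm] using h' (Sum.inl i)
  · simpa [triplePerm] using h' (Sum.inr (Sum.inl i))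
  · simpa [triplePerm] using h' (Sum.inr (Sum.inr i))

lemma rootProd_comp_triplePerm {k b m : ℕ} (x : Fin k ⊕ Fin b → ℚ)
    (y : Fin b ⊕ (Fin m ⊕ Fin k) → ℚ)
    (a : Equiv.Perm (Fin b) × Equiv.Perm (Fin m) × Equiv.Perm (Fin k)) :
    rootProd x (y ∘ triplePerm a) = rootProd x y := by
  simp only [rootProd, triplePerm, Function.comp_apply, Equiv.sumCongr_apply, Sum.map_inl,
    Sum.map_inr]
  congr 2
  · exact Finset.prod_congr rfl fun i _ => Equiv.prod_comp a.1 fun j => x (Sum.inl i) - y (Sum.inl j)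
  · exact Finset.prod_congr rfl fun i _ =>
      Equiv.prod_comp a.2.2 fun j => x (Sum.inr i) - y (Sum.inr (Sum.inr j))
  · exact Finset.prod_congr rfl fun i _ =>
      Equiv.prod_comp a.2.1 fun j => x (Sum.inl i) - y (Sum.inr (Sum.inl j))
  · exact Equiv.prod_comp a.2.1 fun i => ∏ j, (y (Sum.inr (Sum.inl i)) - x (Sum.inr j))

/-- The embedding matching the first two blocks with the fifth and the third. -/
def blockEmb (k b m : ℕ) : Fin k ⊕ Fin b ↪ Fin b ⊕ (Fin m ⊕ Fin k) where
  toFun := Sum.elim (fun i => Sum.inr (Sum.inr i)) Sum.inl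
  inj' := by
    rintro (i | i) (j | j) h <;> simp_all

lemma blockEmb_inl {k b m : ℕ} (i : Fin k) :
    blockEmb k b m (Sum.inl i) = Sum.inr (Sum.inr i) := rfl

lemma blockEmb_inr {k b m : ℕ} (i : Fin b) : blockEmb k b m (Sum.inr i) = Sum.inl i := rfl

lemma mem_range_triplePerm {k b m : ℕ} {y : Fin b ⊕ (Fin m ⊕ Fin k) → ℚ}
    {h : Equiv.Perm (Fin b ⊕ (Fin m ⊕ Fin k))}
    (hr : rootProd (y ∘ blockEmb k b m) (y ∘ h) ≠ 0) : h ∈ Set.range triplePerm := by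
  simp only [rootProd, blockEmb_inl, blockEmb_inr, Function.comp_apply, mul_ne_zero_iff,
    Finset.prod_ne_zero_iff, mem_univ, true_imp_iff, sub_ne_zero] at hr
  obtain ⟨⟨h1, h2⟩, h3, h4⟩ := hr
  have hinl : Set.MapsTo h (Set.range Sum.inl) (Set.range Sum.inl) := by
    rw [Equiv.Perm.perm_mapsTo_inl_iff_mapsTo_inr]
    rintro _ ⟨j, rfl⟩
    rcases hj : h (Sum.inr j) with i | i
    · rcases j with j | j
      · exact absurd (congrArg y hj) (h4 j i)
      · exact absurd (congrArg y hj).symm (h2 i j)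
    · exact ⟨i, rfl⟩
  obtain ⟨⟨a, h'⟩, rfl⟩ := Equiv.Perm.mem_sumCongrHom_range_of_perm_mapsTo_inl hinl
  have hinl' : Set.MapsTo h' (Set.range Sum.inl) (Set.range Sum.inl) := by
    rintro _ ⟨j, rfl⟩
    rcases hj : h' (Sum.inl j) with i | i
    · exact ⟨i, rfl⟩
    · exact absurd (congrArg (fun t => y (Sum.inr t)) hj).symm (h3 i j)
  obtain ⟨⟨c, d⟩, rfl⟩ := Equiv.Perm.mem_sumCongrHom_range_of_perm_mapsTo_inl hinl'
  exact ⟨(a, c, d), rfl⟩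

lemma sum_sign_mul_stairThree_triplePerm {b m k : ℕ} (y : Fin b ⊕ (Fin m ⊕ Fin k) → ℚ) :
    ∑ a : Equiv.Perm (Fin b) × Equiv.Perm (Fin m) × Equiv.Perm (Fin k),
      ((Equiv.Perm.sign (triplePerm a) : ℤ) : ℚ) * stairThree (y ∘ triplePerm a) =
        vdm (y ∘ Sum.inl) * (vdm (y ∘ Sum.inr ∘ Sum.inl) * vdm (y ∘ Sum.inr ∘ Sum.inr)) := by
  rw [← sum_sign_mul_stairProd, ← sum_sign_mul_stairProd, ← sum_sign_mul_stairProd,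
    Finset.sum_mul_sum, Finset.sum_mul_sum, Fintype.sum_prod_type]
  refine Finset.sum_congr rfl fun a _ => ?_
  rw [Fintype.sum_prod_type]
  simp only [Finset.mul_sum]
  refine Finset.sum_congr rfl fun c _ => Finset.sum_congr rfl fun d _ => ?_
  rw [triplePerm, Equiv.Perm.sign_sumCongr, Equiv.Perm.sign_sumCongr]
  have h : stairThree (y ∘ Equiv.sumCongr a (Equiv.sumCongr c d)) =
      stairProd ((y ∘ Sum.inl) ∘ a) * (stairProd ((y ∘ Sum.inr ∘ Sum.inl) ∘ c) *
        stairProd ((y ∘ Sum.inr ∘ Sum.inr) ∘ d)) := rfl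
  rw [h]
  push_cast
  ring

lemma prod_prod_sub_swap {a c : ℕ} (u : Fin a → ℚ) (w : Fin c → ℚ) :
    ∏ i, ∏ j, (u i - w j) = (-1) ^ (a * c) * ∏ j, ∏ i, (w j - u i) := by
  rw [Finset.prod_comm (f := fun j i => w j - u i)]
  simp only [← neg_sub (w _) (u _), Finset.prod_neg, Finset.prod_mul_distrib, Finset.prod_const,
    Finset.card_univ, Fintype.card_fin, ← pow_mul, mul_comm c a]

lemma sum_sign_mul_stairThree_mul_rootProd {k b m : ℕ} (y : Fin b ⊕ (Fin m ⊕ Fin k) → ℚ) :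
    ∑ h : Equiv.Perm (Fin b ⊕ (Fin m ⊕ Fin k)), ((Equiv.Perm.sign h : ℤ) : ℚ) *
      (stairThree (y ∘ h) * rootProd (y ∘ blockEmb k b m) (y ∘ h)) =
        (-1) ^ (k * m + m * b) * crossProd (y ∘ blockEmb k b m) * vdmThree y := by
  rw [← Fintype.sum_of_injective triplePerm triplePerm_injective
    (fun a => ((Equiv.Perm.sign (triplePerm a) : ℤ) : ℚ) * stairThree (y ∘ triplePerm a) *
      rootProd (y ∘ blockEmb k b m) y) _ ?_ ?_]
  · rw [← Finset.sum_mul, sum_sign_mul_stairThree_triplePerm, vdmThree_eq]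
    simp only [rootProd, crossProd, blockEmb_inl, blockEmb_inr, Function.comp_apply]
    rw [prod_prod_sub_swap (fun i : Fin k => y (Sum.inr (Sum.inr i)))
        (fun j : Fin m => y (Sum.inr (Sum.inl j))),
      prod_prod_sub_swap (fun i : Fin m => y (Sum.inr (Sum.inl i)))
        (fun j : Fin b => y (Sum.inl j)), pow_add]
    ring
  · intro h hh
    rw [not_imp_comm.1 mem_range_triplePerm hh, mul_zero, mul_zero]
  · intro a
    rw [rootProd_comp_triplePerm, mul_assoc]

lemma sign_cast_mul_self {ι : Type*} [Fintype ι] [DecidableEq ι] (g : Equiv.Perm ι) :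
    ((Equiv.Perm.sign g : ℤ) : ℚ) * ((Equiv.Perm.sign g : ℤ) : ℚ) = 1 := by
  rw [← Int.cast_mul, ← Units.val_mul, Int.units_mul_self]
  simp

lemma sum_sign_mul_stairThree_mul_rootProd_perm {k b m : ℕ} (y : Fin b ⊕ (Fin m ⊕ Fin k) → ℚ)
    (g : Equiv.Perm (Fin k ⊕ Fin b)) :
    ∑ h : Equiv.Perm (Fin b ⊕ (Fin m ⊕ Fin k)), ((Equiv.Perm.sign h : ℤ) : ℚ) *
      (stairThree (y ∘ h) * rootProd ((y ∘ blockEmb k b m) ∘ g) (y ∘ h)) =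
        (-1) ^ (k * m + m * b) * crossProd ((y ∘ blockEmb k b m) ∘ g) * vdmThree y := by
  obtain ⟨r, hr⟩ : ∃ r : Equiv.Perm (Fin b ⊕ (Fin m ⊕ Fin k)),
      (y ∘ blockEmb k b m) ∘ g = (y ∘ r) ∘ blockEmb k b m :=
    ⟨g.viaEmbedding (blockEmb k b m), by
      ext i
      simp [Equiv.Perm.viaEmbedding_apply]⟩
  have h := sum_sign_mul_stairThree_mul_rootProd (y ∘ r)
  rw [vdmThree_comp_perm] at h
  rw [hr, ← Equiv.sum_comp (Equiv.mulLeft r)]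
  simp only [Equiv.coe_mulLeft, Equiv.Perm.sign_mul, Equiv.Perm.coe_mul, ← Function.comp_assoc,
    Units.val_mul, Int.cast_mul, mul_assoc] at h ⊢
  rw [← Finset.mul_sum, h]
  linear_combination ((-1) ^ (k * m + m * b) * crossProd ((y ∘ r) ∘ blockEmb k b m) *
    vdmThree y) * sign_cast_mul_self r

lemma DSum_lam0 (k b m : ℕ) :
    DSum (k + b) (k + b + m) k (lam0 (k + b) (k + b + m) k) =
      (-1) ^ (k * m + m * b) * ((k + b).choose k : ℚ) := by
  set y : Fin b ⊕ (Fin m ⊕ Fin k) → ℚ := fun i => ((tripleEquiv b m k i : ℕ) : ℚ) with hy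
  have hinj : Function.Injective y := fun i j hij =>
    (tripleEquiv b m k).injective (Fin.ext (Nat.cast_injective (R := ℚ) hij))
  have hx0 : vdmTwo (y ∘ blockEmb k b m) ≠ 0 := vdm_ne_zero
    ((hinj.comp (blockEmb k b m).injective).comp (Equiv.injective _))
  have hy0 : vdmThree y ≠ 0 := vdm_ne_zero (hinj.comp (Equiv.injective _))
  refine mul_right_cancel₀ (mul_ne_zero hx0 hy0) ?_
  rw [DSum_mul_vdm]
  have h : ∀ g : Equiv.Perm (Fin k ⊕ Fin b),
      ∑ h : Equiv.Perm (Fin b ⊕ (Fin m ⊕ Fin k)),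
        ((Equiv.Perm.sign g : ℤ) : ℚ) * ((Equiv.Perm.sign h : ℤ) : ℚ) *
          (stairTwo ((y ∘ blockEmb k b m) ∘ g) * stairThree (y ∘ h) *
            rootProd ((y ∘ blockEmb k b m) ∘ g) (y ∘ h)) =
      (-1) ^ (k * m + m * b) * vdmThree y * (((Equiv.Perm.sign g : ℤ) : ℚ) *
        (stairTwo ((y ∘ blockEmb k b m) ∘ g) * crossProd ((y ∘ blockEmb k b m) ∘ g))) := by
    intro g
    have hg := sum_sign_mul_stairThree_mul_rootProd_perm y g
    have hfac : (-1) ^ (k * m + m * b) * vdmThree y * (((Equiv.Perm.sign g : ℤ) : ℚ) *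
        (stairTwo ((y ∘ blockEmb k b m) ∘ g) * crossProd ((y ∘ blockEmb k b m) ∘ g))) =
        ((Equiv.Perm.sign g : ℤ) : ℚ) * stairTwo ((y ∘ blockEmb k b m) ∘ g) *
          ((-1) ^ (k * m + m * b) * crossProd ((y ∘ blockEmb k b m) ∘ g) * vdmThree y) := by
      ring
    rw [hfac, ← hg, Finset.mul_sum]
    refine Finset.sum_congr rfl fun h _ => ?_
    ring
  rw [Finset.sum_congr rfl fun g _ => h g, ← Finset.mul_sum, sum_sign_mul_stairTwo_mul_crossProd]
  ring

/-- Evaluating the alternating double sum at the special point `λ_0` gives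
`(−1)^{k(p−k)+k(q−p)+(p−k)(q−p+k)} · (p choose k)`. -/
theorem stmt_2 (p q k : ℕ) (hp : 1 ≤ p) (hpq : p ≤ q) (hk : k ≤ p) :
    DSum p q k (lam0 p q k) =
      (-1 : ℚ) ^ (k * (p - k) + k * (q - p) + (p - k) * (q - p + k)) * (p.choose k) := by
  obtain ⟨b, rfl⟩ := Nat.exists_eq_add_of_le hk
  obtain ⟨m, rfl⟩ := Nat.exists_eq_add_of_le hpq
  rw [DSum_lam0, show k + b - k = b by omega, show k + b + m - (k + b) = m by omega]
  congr 1
  have h : (-1 : ℚ) ^ (2 * (k * b)) = 1 := by rw [pow_mul, neg_one_sq, one_pow]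
  rw [show k * b + k * m + b * (m + k) = (k * m + m * b) + 2 * (k * b) by ring,
    pow_add _ (k * m + m * b), h, mul_one]
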